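/- Let s ≥ 2 be an integer, let 0 < p < (s−1)/s, and set δ = (s−1)/s − p. Let t ≥ 1 and let 𝓕 be a left-shifted s-wise t-intersecting family of subsets of [n]. Then μ_p(𝓕) ≤ e^{−2tδ²} / (1 − e^{−2sδ²}). -/

import Mathlib

/-- The `(i,j)`-shift of a family `𝓕` of subsets of `[n] = {0,…,n-1}`. -/
def shiftFamily (n : ℕ) (i j : Fin n) (𝓕 : Finset (Finset (Fin n))) :
    Finset (Finset (Fin n)) :=
  𝓕.image (fun F =>
    if j ∈ F ∧ i ∉ F ∧ insert i (F.erase j) ∉ 𝓕 then insert i (F.erase j) else F)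

/-- A family is `s`-wise `t`-intersecting if any `s` members (repetitions allowed)
have intersection of size at least `t`. -/
def SwiseTIntersecting (n s t : ℕ) (𝓕 : Finset (Finset (Fin n))) : Prop :=
  ∀ G : Fin s → Finset (Fin n), (∀ a, G a ∈ 𝓕) → t ≤ (Finset.univ.inf G).card

/-- A family is left-shifted if it is invariant under all `(i,j)`-shifts with `i < j`. -/
def LeftShifted (n : ℕ) (𝓕 : Finset (Finset (Fin n))) : Prop :=
  ∀ i j : Fin n, i < j → shiftFamily n i j 𝓕 = 𝓕

/-- The `p`-biased weight of a subset `F ⊆ [n]`: `μ_p(F) = p^|F| (1-p)^(n-|F|)`. -/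
noncomputable def mu (p : ℝ) (n : ℕ) (F : Finset (Fin n)) : ℝ :=
  p ^ F.card * (1 - p) ^ (n - F.card)

open Finset in
/-- In a left-shifted family, an element of a member can be traded for a smaller non-element. -/
lemma LeftShifted.insert_erase_mem {n : ℕ} {𝓕 : Finset (Finset (Fin n))} (h : LeftShifted n 𝓕)
    {F : Finset (Fin n)} (hF : F ∈ 𝓕) {i j : Fin n} (hij : i < j) (hj : j ∈ F) (hi : i ∉ F) :
    insert i (F.erase j) ∈ 𝓕 := by
  by_contra hn
  have hmem : insert i (F.erase j) ∈ shiftFamily n i j 𝓕 :=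
    mem_image.2 ⟨F, hF, if_pos ⟨hj, hi, hn⟩⟩
  rw [h i j hij] at hmem
  exact hn hmem

open Finset in
/-- If every initial segment ending in `B` contains at least as many non-elements of `F` as
elements of `B`, then some member of the left-shifted family avoids `B`. -/
lemma LeftShifted.exists_disjoint {n : ℕ} {𝓕 : Finset (Finset (Fin n))} (h : LeftShifted n 𝓕)
    {F B : Finset (Fin n)} (hF : F ∈ 𝓕)
    (hB : ∀ x ∈ B, #(B ∩ Iic x) ≤ #(Fᶜ ∩ Iic x)) :
    ∃ G ∈ 𝓕, Disjoint G B := by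
  classical
  obtain ⟨G, hG, hmin⟩ := exists_min_image
    (𝓕.filter fun G => ∀ x ∈ B, #(B ∩ Iic x) ≤ #(Gᶜ ∩ Iic x))
    (fun G => ∑ x ∈ G, (x : ℕ)) ⟨F, mem_filter.2 ⟨hF, hB⟩⟩
  obtain ⟨hGF, hGB⟩ := mem_filter.1 hG
  refine ⟨G, hGF, ?_⟩
  by_contra hd
  obtain ⟨b, hbG, hbB⟩ := not_disjoint_iff.1 hd
  have hne : (Gᶜ ∩ Iic b).Nonempty := by
    rw [← card_pos]
    exact (card_pos.2 ⟨b, by simp [hbB]⟩).trans_le (hGB b hbB)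
  obtain ⟨c, hc, hcmax⟩ := exists_max_image _ id hne
  simp only [mem_inter, mem_compl, mem_Iic, id] at hc hcmax
  obtain ⟨hcG, hcb⟩ := hc
  have hlt : c < b := lt_of_le_of_ne hcb fun e => hcG (e ▸ hbG)
  have hcompl : ∀ x, (insert c (G.erase b))ᶜ ∩ Iic x
      = (insert b (Gᶜ.erase c)) ∩ Iic x := by
    intro x
    ext y
    simp only [mem_inter, mem_compl, mem_insert, mem_erase]
    grind
  have hmem : insert c (G.erase b) ∈
      𝓕.filter fun G => ∀ x ∈ B, #(B ∩ Iic x) ≤ #(Gᶜ ∩ Iic x) := by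
    refine mem_filter.2 ⟨h.insert_erase_mem hGF hlt hbG hcG, fun x hx => ?_⟩
    rw [hcompl]
    rcases lt_or_ge x b with hxb | hbx
    · have h1 : #((B ∩ Iic x)) + 1 ≤ #(B ∩ Iic b) := by
        rw [← card_insert_of_notMem (a := b) (s := B ∩ Iic x) (by simp [hxb])]
        refine card_le_card fun y hy => ?_
        simp only [mem_inter, mem_insert, mem_Iic] at hy ⊢
        rcases hy with rfl | ⟨hy, hyx⟩
        · exact ⟨hbB, le_rfl⟩
        · exact ⟨hy, hyx.trans hxb.le⟩
      rcases lt_or_ge x c with hxc | hcx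
      · refine (hGB x hx).trans (card_le_card fun y hy => ?_)
        simp only [mem_inter, mem_insert, mem_Iic, mem_erase] at hy ⊢
        exact ⟨Or.inr ⟨(hy.2.trans_lt hxc).ne, hy.1⟩, hy.2⟩
      · have h2 : #(Gᶜ ∩ Iic b) ≤ #((insert b (Gᶜ.erase c)) ∩ Iic x) + 1 := by
          refine (card_le_card (t := insert c ((insert b (Gᶜ.erase c)) ∩ Iic x))
            fun y hy => ?_).trans (card_insert_le _ _)
          simp only [mem_inter, mem_insert, mem_Iic, mem_erase, mem_compl] at hy ⊢
          have := hcmax y hy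
          by_cases hyc : y = c
          · exact Or.inl hyc
          · exact Or.inr ⟨Or.inr ⟨hyc, hy.1⟩, this.trans hcx⟩
        have := hGB b hbB
        omega
    · have hbnot : b ∉ Gᶜ := by simpa using hbG
      have he : insert b (Gᶜ.erase c) ∩ Iic x = insert b ((Gᶜ ∩ Iic x).erase c) := by
        ext y
        simp only [mem_inter, mem_insert, mem_Iic, mem_erase]
        grind
      rw [he, card_insert_of_notMem (by simp [hbG]),
        card_erase_add_one (by simp [hcG, hcb.trans hbx])]
      exact hGB x hx
  have hle := hmin _ hmem
  rw [sum_insert (by simp [hcG]), ← add_sum_erase G _ hbG] at hle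
  have : (c : ℕ) < b := hlt
  omega

open Finset in
/-- Every member of a left-shifted `s`-wise `t`-intersecting family has at least `t + (s - 1) i`
elements among the first `t + s i` points, for some `i`. -/
lemma SwiseTIntersecting.exists_le_card_filter {n s t : ℕ} (hs : 1 ≤ s) (ht : 1 ≤ t)
    {𝓕 : Finset (Finset (Fin n))} (hint : SwiseTIntersecting n s t 𝓕) (hls : LeftShifted n 𝓕)
    {F : Finset (Fin n)} (hF : F ∈ 𝓕) :
    ∃ i, t + s * i ≤ n ∧ t + s * i ≤ #{x ∈ F | x.val < t + s * i} + i := by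
  by_contra! hcon
  have hG : ∀ j : Fin s, ∃ G ∈ 𝓕,
      Disjoint G (univ.filter fun x => t - 1 ≤ x.val ∧ (x.val - (t - 1)) % s = j) := by
    intro j
    refine hls.exists_disjoint hF fun x hx => ?_
    simp only [mem_filter, mem_univ, true_and] at hx
    set i := (x.val - (t - 1)) / s with hi
    have hdiv : s * i + j = x.val - (t - 1) := by
      rw [← hx.2]; exact Nat.div_add_mod _ _
    have hxn := x.isLt
    have hle : t + s * i ≤ n := by omega
    have hcard := hcon i hle
    have h1 : #(({x | t - 1 ≤ x.val ∧ (x.val - (t - 1)) % s = j} : Finset (Fin n)) ∩ Iic x) ≤ i + 1 := by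
      rw [← card_range (i + 1)]
      refine card_le_card_of_injOn (fun y => (y.val - (t - 1)) / s) (fun y hy => ?_) ?_
      · simp only [coe_inter, Set.mem_inter_iff, mem_coe, mem_Iic, Fin.le_def] at hy
        simp only [coe_range, Set.mem_Iio, Nat.lt_succ_iff]
        exact Nat.div_le_div_right (by omega)
      · intro y hy z hz hyz
        simp only [coe_inter, Set.mem_inter_iff, mem_coe, mem_filter, mem_univ, true_and] at hy hz
        have hy' := Nat.div_add_mod (y.val - (t - 1)) s
        have hz' := Nat.div_add_mod (z.val - (t - 1)) s
        simp only at hyz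
        rw [hy.1.2, hyz] at hy'
        rw [hz.1.2] at hz'
        ext
        omega
    have h2 : #{y : Fin n | y.val < t + s * i} = t + s * i := by
      rw [Fin.card_filter_val_lt]; omega
    have h3 : #{y : Fin n | y.val < t + s * i} ≤
        #{y ∈ F | y.val < t + s * i} + #(Fᶜ ∩ Iic x) := by
      refine (card_le_card fun y hy => ?_).trans (card_union_le _ _)
      simp only [mem_filter, mem_univ, true_and, mem_union, mem_inter, mem_compl, mem_Iic,
        Fin.le_def] at hy ⊢
      by_cases hyF : y ∈ F
      · exact Or.inl ⟨hyF, hy⟩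
      · exact Or.inr ⟨hyF, by omega⟩
    omega
  choose G hG𝓕 hGd using hG
  have hsub : univ.inf G ⊆ ({x : Fin n | x.val < t - 1} : Finset (Fin n)) := by
    intro x hx
    simp only [mem_filter, mem_univ, true_and]
    by_contra! hxt
    let j : Fin s := ⟨(x.val - (t - 1)) % s, Nat.mod_lt _ hs⟩
    have hxj : x ∈ G j := (Finset.inf_le (f := G) (mem_univ j)) hx
    exact disjoint_left.1 (hGd j) hxj (mem_filter.2 ⟨mem_univ x, hxt, rfl⟩)
  have h1 := (hint G hG𝓕).trans (card_le_card hsub)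
  rw [Fin.card_filter_val_lt] at h1
  omega

open MeasureTheory ProbabilityTheory in
/-- Hoeffding's lemma for a Bernoulli variable. -/
lemma one_sub_add_mul_exp_le {p : ℝ} (h0 : 0 ≤ p) (h1 : p ≤ 1) (l : ℝ) :
    1 - p + p * Real.exp l ≤ Real.exp (l * p + l ^ 2 / 8) := by
  let μ : Measure ℝ := ENNReal.ofReal p • Measure.dirac 1 + ENNReal.ofReal (1 - p) • Measure.dirac 0
  have hint : ∀ f : ℝ → ℝ, ∫ x, f x ∂μ = p * f 1 + (1 - p) * f 0 := by
    intro f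
    rw [integral_add_measure ((integrable_dirac (by simp)).smul_measure (by simp))
      ((integrable_dirac (by simp)).smul_measure (by simp)), integral_smul_measure,
      integral_smul_measure, integral_dirac, integral_dirac, ENNReal.toReal_ofReal h0,
      ENNReal.toReal_ofReal (by linarith)]
    simp
  have : IsProbabilityMeasure μ := ⟨by
    simp [μ, ← ENNReal.ofReal_add h0 (sub_nonneg.2 h1)]⟩
  have hsub := (hasSubgaussianMGF_of_mem_Icc (μ := μ) (X := fun x => x) (a := 0) (b := 1)
    aemeasurable_id (ae_add_measure_iff.2 ⟨Measure.ae_smul_measure (by simp) _,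
      Measure.ae_smul_measure (by simp) _⟩)).mgf_le l
  rw [mgf, hint, hint] at hsub
  have hm := mul_le_mul_of_nonneg_left hsub (Real.exp_pos (l * p)).le
  rw [← Real.exp_add] at hm
  have e1 : Real.exp (l * p) * Real.exp (l * (1 - p)) = Real.exp l := by
    rw [← Real.exp_add]; ring_nf
  have e2 : Real.exp (l * p) * Real.exp (l * (0 - p)) = 1 := by
    rw [← Real.exp_add]; ring_nf; simp
  norm_num at hm e2
  have e3 : l * p + 1 / 4 * l ^ 2 / 2 = l * p + l ^ 2 / 8 := by ring
  rw [e3] at hm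
  linear_combination hm - p * e1 - (1 - p) * e2

open Finset in
/-- The moment generating function of the size of the intersection with the first `m` points. -/
lemma sum_mu_mul_exp {n m : ℕ} (hm : m ≤ n) (p l : ℝ) :
    ∑ F : Finset (Fin n), mu p n F * Real.exp (l * #{x ∈ F | x.val < m}) =
      (1 - p + p * Real.exp l) ^ m := by
  have h := Finset.prod_add (fun x : Fin n => p * (if x.val < m then Real.exp l else 1))
    (fun _ => 1 - p) univ
  rw [powerset_univ] at h
  have hl : ∏ x : Fin n, (p * (if x.val < m then Real.exp l else 1) + (1 - p)) =
      (1 - p + p * Real.exp l) ^ m := by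
    have : ∀ x : Fin n, p * (if x.val < m then Real.exp l else 1) + (1 - p) =
        if x.val < m then 1 - p + p * Real.exp l else 1 := by
      intro x; split_ifs <;> ring
    rw [prod_congr rfl fun x _ => this x, prod_ite, prod_const, prod_const_one, mul_one,
      Fin.card_filter_val_lt, min_eq_right hm]
  rw [← hl, h]
  refine sum_congr rfl fun F _ => ?_
  rw [prod_mul_distrib, prod_const, prod_const, prod_ite, prod_const, prod_const_one, mul_one,
    card_sdiff_of_subset (subset_univ F), card_univ, Fintype.card_fin, mu, mul_comm l,
    Real.exp_nat_mul]
  ring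

lemma mu_nonneg {p : ℝ} (h0 : 0 ≤ p) (h1 : p ≤ 1) (n : ℕ) (F : Finset (Fin n)) : 0 ≤ mu p n F :=
  mul_nonneg (pow_nonneg h0 _) (pow_nonneg (sub_nonneg.2 h1) _)

open Finset in
/-- Hoeffding's inequality for the number of elements among the first `m` points. -/
lemma sum_mu_filter_le {n m : ℕ} (hm : m ≤ n) {p δ a : ℝ} (h0 : 0 ≤ p) (h1 : p ≤ 1) (hδ : 0 ≤ δ)
    (ha : (p + δ) * m ≤ a) :
    ∑ F : Finset (Fin n) with a ≤ #{x ∈ F | x.val < m}, mu p n F ≤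
      Real.exp (-2 * m * δ ^ 2) := by
  calc ∑ F : Finset (Fin n) with a ≤ #{x ∈ F | x.val < m}, mu p n F
      ≤ ∑ F : Finset (Fin n) with a ≤ #{x ∈ F | x.val < m},
          mu p n F * Real.exp (4 * δ * #{x ∈ F | x.val < m}) * Real.exp (-(4 * δ * a)) := by
        refine sum_le_sum fun F hF => ?_
        rw [mul_assoc, ← Real.exp_add]
        refine le_mul_of_one_le_right (mu_nonneg h0 h1 n F) (Real.one_le_exp ?_)
        have := mul_le_mul_of_nonneg_left (mem_filter.1 hF).2 hδ
        linarith
    _ ≤ ∑ F : Finset (Fin n),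
          mu p n F * Real.exp (4 * δ * #{x ∈ F | x.val < m}) * Real.exp (-(4 * δ * a)) :=
        sum_le_univ_sum_of_nonneg fun F => mul_nonneg
          (mul_nonneg (mu_nonneg h0 h1 n F) (Real.exp_pos _).le) (Real.exp_pos _).le
    _ = (1 - p + p * Real.exp (4 * δ)) ^ m * Real.exp (-(4 * δ * a)) := by
        rw [← sum_mul, sum_mu_mul_exp hm]
    _ ≤ Real.exp (4 * δ * p + (4 * δ) ^ 2 / 8) ^ m * Real.exp (-(4 * δ * a)) := by
        have : 0 ≤ 1 - p + p * Real.exp (4 * δ) :=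
          add_nonneg (sub_nonneg.2 h1) (mul_nonneg h0 (Real.exp_pos _).le)
        gcongr
        exact one_sub_add_mul_exp_le h0 h1 _
    _ ≤ Real.exp (-2 * m * δ ^ 2) := by
        rw [← Real.exp_nat_mul, ← Real.exp_add]
        have := mul_le_mul_of_nonneg_left ha hδ
        exact Real.exp_le_exp.2 (by linarith)

/-- A left-shifted `s`-wise `t`-intersecting family with `p < (s-1)/s` and
`δ = (s-1)/s - p` has `μ_p`-weight at most `e^{-2tδ²} / (1 - e^{-2sδ²})`. -/
theorem left_shifted_weight_bound (n s t : ℕ) (hs : 2 ≤ s) (ht : 1 ≤ t) (p : ℝ)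
    (hp0 : 0 < p) (hp1 : p < ((s : ℝ) - 1) / s)
    (δ : ℝ) (hδ : δ = ((s : ℝ) - 1) / s - p)
    (𝓕 : Finset (Finset (Fin n)))
    (hls : LeftShifted n 𝓕) (hint : SwiseTIntersecting n s t 𝓕) :
    ∑ F ∈ 𝓕, mu p n F ≤
      Real.exp (-2 * t * δ ^ 2) / (1 - Real.exp (-2 * s * δ ^ 2)) := by
  classical
  have hs0 : (0 : ℝ) < s := by positivity
  have hδ0 : 0 < δ := by linarith
  have hple : p ≤ 1 := hp1.le.trans ((div_le_one hs0).2 (by linarith))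
  set r := Real.exp (-2 * s * δ ^ 2) with hr
  have hr1 : r < 1 := by
    have : 0 < s * δ ^ 2 := by positivity
    exact Real.exp_lt_one_iff.2 (by linarith)
  let I := (Finset.range (n + 1)).filter fun i => t + s * i ≤ n
  let T : ℕ → Finset (Finset (Fin n)) := fun i => Finset.univ.filter fun F =>
    (t + s * i - i : ℝ) ≤ (F.filter fun x => x.val < t + s * i).card
  have hcover : ∀ F ∈ 𝓕, ∃ i ∈ I, F ∈ T i := by
    intro F hF
    obtain ⟨i, hin, hi⟩ := hint.exists_le_card_filter (by omega) ht hls hF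
    refine ⟨i, Finset.mem_filter.2 ⟨Finset.mem_range.2 ?_, hin⟩,
      Finset.mem_filter.2 ⟨Finset.mem_univ _, ?_⟩⟩
    · nlinarith
    · have : ((t + s * i : ℕ) : ℝ) ≤ _ := Nat.cast_le.2 hi
      push_cast at this
      linarith
  have hT : ∀ i ∈ I, ∑ F ∈ T i, mu p n F ≤ Real.exp (-2 * t * δ ^ 2) * r ^ i := by
    intro i hi
    refine (sum_mu_filter_le (δ := δ) (Finset.mem_filter.1 hi).2 hp0.le hple hδ0.le ?_).trans_eq ?_
    · have hpδ : p + δ = 1 - 1 / s := by rw [hδ]; field_simp; ring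
      have : (1 - 1 / (s : ℝ)) * (t + s * i) = t + s * i - i - t / s := by field_simp; ring
      rw [hpδ]
      push_cast
      rw [this]
      have : (0 : ℝ) ≤ t / s := by positivity
      linarith
    · rw [hr, ← Real.exp_nat_mul, ← Real.exp_add]
      push_cast
      ring_nf
  calc ∑ F ∈ 𝓕, mu p n F ≤ ∑ F ∈ 𝓕, ∑ i ∈ I, if F ∈ T i then mu p n F else 0 := by
        refine Finset.sum_le_sum fun F hF => ?_
        obtain ⟨i, hi, hFi⟩ := hcover F hF
        have hle := Finset.single_le_sum (f := fun i => if F ∈ T i then mu p n F else 0)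
          (fun k _ => ite_nonneg (mu_nonneg hp0.le hple n F) le_rfl) hi
        simpa only [if_pos hFi] using hle
    _ = ∑ i ∈ I, ∑ F ∈ 𝓕 with F ∈ T i, mu p n F := by
        rw [Finset.sum_comm]
        exact Finset.sum_congr rfl fun i _ => (Finset.sum_filter _ _).symm
    _ ≤ ∑ i ∈ I, ∑ F ∈ T i, mu p n F :=
        Finset.sum_le_sum fun i _ => Finset.sum_le_sum_of_subset_of_nonneg
          (fun F hF => (Finset.mem_filter.1 hF).2) fun F _ _ => mu_nonneg hp0.le hple n F
    _ ≤ ∑ i ∈ I, Real.exp (-2 * t * δ ^ 2) * r ^ i := Finset.sum_le_sum hT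
    _ ≤ ∑' i, Real.exp (-2 * t * δ ^ 2) * r ^ i :=
        ((summable_geometric_of_lt_one (Real.exp_pos _).le hr1).mul_left _).sum_le_tsum _
          fun i _ => by positivity
    _ = Real.exp (-2 * t * δ ^ 2) / (1 - r) := by
        rw [tsum_mul_left, tsum_geometric_of_lt_one (Real.exp_pos _).le hr1, div_eq_mul_inv]
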